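/- arXiv:1509.04453 — 5 statements merged into one kernel-verified Lean document; each statement's English description precedes it below -/
import Mathlib

section
/- Let H₁ and H₂ be real Hilbert spaces, A : H₁ → H₂ a bounded linear operator with adjoint A*, u ∈ H₂, and α, K real numbers with K + α > 0. Fix g ∈ H₁ and define Jˢ(f, g) = ‖A f − u‖² + α‖f‖² + K‖f − g‖² − ‖A(f − g)‖². Then the function f ↦ Jˢ(f, g) has the unique global minimizer f* = (1/(K + α)) (K g − A*(A g − u)). -/
/-- For `K + α > 0` and fixed `g`, the surrogate functional
`f ↦ Jˢ(f, g) = ‖A f − u‖² + α‖f‖² + K‖f − g‖² − ‖A(f − g)‖²`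
has the unique global minimizer `f* = (1/(K + α)) (K g − A*(A g − u))`. -/
theorem surrogate_functional_unique_minimizer
    {H₁ H₂ : Type*}
    [NormedAddCommGroup H₁] [InnerProductSpace ℝ H₁] [CompleteSpace H₁]
    [NormedAddCommGroup H₂] [InnerProductSpace ℝ H₂] [CompleteSpace H₂]
    (A : H₁ →L[ℝ] H₂) (u : H₂) (α K : ℝ) (hKα : 0 < K + α) (g : H₁)
    (fstar : H₁)
    (hfstar : fstar = (1 / (K + α)) • (K • g - ContinuousLinearMap.adjoint A (A g - u))) :
    (∀ f : H₁,
      (‖A fstar - u‖ ^ 2 + α * ‖fstar‖ ^ 2) + K * ‖fstar - g‖ ^ 2 - ‖A (fstar - g)‖ ^ 2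
        ≤ (‖A f - u‖ ^ 2 + α * ‖f‖ ^ 2) + K * ‖f - g‖ ^ 2 - ‖A (f - g)‖ ^ 2) ∧
    (∀ f : H₁, f ≠ fstar →
      (‖A fstar - u‖ ^ 2 + α * ‖fstar‖ ^ 2) + K * ‖fstar - g‖ ^ 2 - ‖A (fstar - g)‖ ^ 2
        < (‖A f - u‖ ^ 2 + α * ‖f‖ ^ 2) + K * ‖f - g‖ ^ 2 - ‖A (f - g)‖ ^ 2) := by
  have h1 : (K + α) • fstar = K • g - ContinuousLinearMap.adjoint A (A g - u) := by
    rw [hfstar, smul_smul, mul_one_div_cancel hKα.ne', one_smul]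
  have h2 : ∀ f : H₁, (K + α) * inner ℝ f fstar
      = K * inner ℝ f g - (inner ℝ (A f) (A g) - inner ℝ (A f) u) := by
    intro f
    rw [← inner_smul_right, h1, inner_sub_right, inner_smul_right,
      ContinuousLinearMap.adjoint_inner_right, inner_sub_right]
  have h3 : ∀ f : H₁, (‖A f - u‖ ^ 2 + α * ‖f‖ ^ 2) + K * ‖f - g‖ ^ 2 - ‖A (f - g)‖ ^ 2
      = (K + α) * ‖f - fstar‖ ^ 2 + (‖u‖ ^ 2 + K * ‖g‖ ^ 2 - ‖A g‖ ^ 2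
        - (K + α) * ‖fstar‖ ^ 2) := by
    intro f
    have := h2 f
    rw [map_sub, norm_sub_sq_real, norm_sub_sq_real, norm_sub_sq_real, norm_sub_sq_real]
    linear_combination 2 * this
  refine ⟨fun f => ?_, fun f hf => ?_⟩
  · rw [h3 f, h3 fstar, sub_self, norm_zero]
    have : 0 ≤ (K + α) * ‖f - fstar‖ ^ 2 := by positivity
    linarith
  · rw [h3 f, h3 fstar, sub_self, norm_zero]
    have h4 : 0 < ‖f - fstar‖ := norm_pos_iff.mpr (sub_ne_zero.mpr hf)
    have : 0 < (K + α) * ‖f - fstar‖ ^ 2 := by positivity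
    linarith
end

section
/- Let H₁ and H₂ be real Hilbert spaces, A : H₁ → H₂ a bounded linear operator with adjoint A*, and K > 0 a constant such that ‖A f‖² ≤ K‖f‖² for all f ∈ H₁. Then for every v ∈ H₁, ‖K v − A*(A v)‖ ≤ K‖v‖. -/
/-- If `‖A f‖² ≤ K‖f‖²` for all `f` with `K > 0`, then `‖K v − A*(A v)‖ ≤ K‖v‖`
for every `v`. -/
theorem norm_K_sub_adjoint_comp_le
    {H₁ H₂ : Type*}
    [NormedAddCommGroup H₁] [InnerProductSpace ℝ H₁] [CompleteSpace H₁]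
    [NormedAddCommGroup H₂] [InnerProductSpace ℝ H₂] [CompleteSpace H₂]
    (A : H₁ →L[ℝ] H₂) (K : ℝ) (hK : 0 < K)
    (hKA : ∀ f : H₁, ‖A f‖ ^ 2 ≤ K * ‖f‖ ^ 2) :
    ∀ v : H₁, ‖K • v - ContinuousLinearMap.adjoint A (A v)‖ ≤ K * ‖v‖ := by
  intro v
  set w := ContinuousLinearMap.adjoint A (A v) with hw
  have h1 : inner ℝ v w = ‖A v‖ ^ 2 := by
    rw [hw, ContinuousLinearMap.adjoint_inner_right, real_inner_self_eq_norm_sq]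
  have h2 : inner ℝ (A w) (A v) = ‖w‖ ^ 2 := by
    rw [← ContinuousLinearMap.adjoint_inner_right, ← hw, real_inner_self_eq_norm_sq]
  have h3 : ‖A w - K • A v‖ ^ 2 = ‖A w‖ ^ 2 - 2 * (K * ‖w‖ ^ 2) + K ^ 2 * ‖A v‖ ^ 2 := by
    rw [norm_sub_sq_real, real_inner_smul_right, h2, norm_smul, mul_pow, Real.norm_eq_abs, sq_abs]
  have h4 : ‖K • v - w‖ ^ 2 = K ^ 2 * ‖v‖ ^ 2 - 2 * (K * ‖A v‖ ^ 2) + ‖w‖ ^ 2 := by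
    rw [norm_sub_sq_real, real_inner_smul_left, h1, norm_smul, mul_pow, Real.norm_eq_abs, sq_abs]
  have h5 : ‖w‖ ^ 2 ≤ K * ‖A v‖ ^ 2 := by
    have := hKA w
    have h6 := sq_nonneg ‖A w - K • A v‖
    refine le_of_mul_le_mul_left ?_ hK
    nlinarith
  have h7 : 0 ≤ K * ‖A v‖ ^ 2 := by positivity
  refine (sq_le_sq₀ (norm_nonneg _) (by positivity)).1 ?_
  rw [h4, mul_pow]
  linarith
end

section
/- Let H₁ and H₂ be real Hilbert spaces, A : H₁ → H₂ a bounded linear operator with adjoint A*, u ∈ H₂, α > 0, and K > 0 a constant such that ‖A f‖² ≤ K‖f‖² for all f ∈ H₁. Define the iteration map Φ(f) = (1/(K + α)) (K f − A*(A f − u)). Then for all f₁, f₂ ∈ H₁, ‖Φ(f₁) − Φ(f₂)‖ ≤ (K/(K + α)) ‖f₁ − f₂‖; in particular Φ is a contraction with Lipschitz constant K/(K + α) < 1. -/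
/-- The iterative thresholding map `Φ(f) = (1/(K+α))(K f − A*(A f − u))` is a contraction
with Lipschitz constant `K/(K+α) < 1`, provided `α > 0`, `K > 0` and `‖A f‖² ≤ K‖f‖²`. -/
theorem iterative_thresholding_map_contraction
    {H₁ H₂ : Type*}
    [NormedAddCommGroup H₁] [InnerProductSpace ℝ H₁] [CompleteSpace H₁]
    [NormedAddCommGroup H₂] [InnerProductSpace ℝ H₂] [CompleteSpace H₂]
    (A : H₁ →L[ℝ] H₂) (u : H₂) (α K : ℝ) (hα : 0 < α) (hK : 0 < K)
    (hKA : ∀ f : H₁, ‖A f‖ ^ 2 ≤ K * ‖f‖ ^ 2)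
    (Φ : H₁ → H₁)
    (hΦ : ∀ f : H₁,
      Φ f = (1 / (K + α)) • (K • f - ContinuousLinearMap.adjoint A (A f - u))) :
    (∀ f₁ f₂ : H₁, ‖Φ f₁ - Φ f₂‖ ≤ (K / (K + α)) * ‖f₁ - f₂‖) ∧ K / (K + α) < 1 := by
  have hpos : 0 < K + α := by linarith
  refine ⟨fun f₁ f₂ => ?_, by rw [div_lt_one hpos]; linarith⟩
  have hadj : ∀ y : H₂, ‖ContinuousLinearMap.adjoint A y‖ ^ 2 ≤ K * ‖y‖ ^ 2 := by
    intro y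
    set z := ContinuousLinearMap.adjoint A y with hz
    have h1 : ‖z‖ ^ 2 ≤ ‖A z‖ * ‖y‖ := by
      have h : inner ℝ z z = inner ℝ (A z) y := by
        conv_lhs => rw [hz]
        rw [← hz, hz, ContinuousLinearMap.adjoint_inner_right]
      rw [← real_inner_self_eq_norm_sq, h]
      exact real_inner_le_norm _ _
    have h2 := hKA z
    by_cases h0 : ‖z‖ = 0
    · rw [h0, zero_pow two_ne_zero]; positivity
    · have hp : 0 < ‖z‖ ^ 2 := by positivity
      have h3 : (‖z‖ ^ 2) ^ 2 ≤ (‖A z‖ * ‖y‖) ^ 2 := by gcongr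
      have h4 : ‖A z‖ ^ 2 * ‖y‖ ^ 2 ≤ K * ‖z‖ ^ 2 * ‖y‖ ^ 2 := by gcongr
      refine le_of_mul_le_mul_left ?_ hp
      nlinarith
  have hmain : ∀ g : H₁, ‖K • g - ContinuousLinearMap.adjoint A (A g)‖ ≤ K * ‖g‖ := by
    intro g
    refine (abs_le_of_sq_le_sq' ?_ (by positivity)).2
    rw [norm_sub_sq_real, ContinuousLinearMap.adjoint_inner_right, map_smul, inner_smul_left,
      real_inner_self_eq_norm_sq, norm_smul, Real.norm_of_nonneg hK.le]
    have := hadj (A g)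
    have h5 : 0 ≤ K * ‖A g‖ ^ 2 := by positivity
    simp only [conj_trivial]
    linarith
  have he : Φ f₁ - Φ f₂ = (1 / (K + α)) •
      (K • (f₁ - f₂) - ContinuousLinearMap.adjoint A (A (f₁ - f₂))) := by
    rw [hΦ, hΦ, ← smul_sub]
    congr 1
    simp only [map_sub, smul_sub]
    abel
  rw [he, norm_smul, Real.norm_of_nonneg (by positivity)]
  calc _ ≤ 1 / (K + α) * (K * ‖f₁ - f₂‖) := by gcongr; exact hmain _
    _ = _ := by ring
end

section
/- Let H₁ and H₂ be real Hilbert spaces, A : H₁ → H₂ a bounded linear operator with adjoint A*, u ∈ H₂, α > 0, and K > 0 a constant such that ‖A f‖² ≤ K‖f‖² for all f ∈ H₁. Define Φ(f) = (1/(K + α)) (K f − A*(A f − u)). Then for every initial guess f₀ ∈ H₁, the sequence defined by f_{m+1} = Φ(f_m) converges strongly in H₁ to the unique global minimizer of the Tikhonov functional J(f) = ‖A f − u‖² + α‖f‖². -/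
/-- Convergence of the iterative thresholding algorithm: for any initial guess `f₀`,
the iterates of `Φ(f) = (1/(K+α))(K f − A*(A f − u))` converge strongly to the unique
global minimizer of the Tikhonov functional `J(f) = ‖A f − u‖² + α‖f‖²`. -/
theorem iterative_thresholding_converges_to_minimizer
    {H₁ H₂ : Type*}
    [NormedAddCommGroup H₁] [InnerProductSpace ℝ H₁] [CompleteSpace H₁]
    [NormedAddCommGroup H₂] [InnerProductSpace ℝ H₂] [CompleteSpace H₂]
    (A : H₁ →L[ℝ] H₂) (u : H₂) (α K : ℝ) (hα : 0 < α) (hK : 0 < K)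
    (hKA : ∀ f : H₁, ‖A f‖ ^ 2 ≤ K * ‖f‖ ^ 2)
    (Φ : H₁ → H₁)
    (hΦ : ∀ f : H₁,
      Φ f = (1 / (K + α)) • (K • f - ContinuousLinearMap.adjoint A (A f - u)))
    (f₀ : H₁) (seq : ℕ → H₁) (hseq0 : seq 0 = f₀)
    (hseq : ∀ m : ℕ, seq (m + 1) = Φ (seq m)) :
    ∃ fstar : H₁,
      (∀ f : H₁, ‖A fstar - u‖ ^ 2 + α * ‖fstar‖ ^ 2 ≤ ‖A f - u‖ ^ 2 + α * ‖f‖ ^ 2) ∧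
      (∀ f : H₁, (∀ g : H₁, ‖A f - u‖ ^ 2 + α * ‖f‖ ^ 2 ≤ ‖A g - u‖ ^ 2 + α * ‖g‖ ^ 2)
        → f = fstar) ∧
      Filter.Tendsto seq Filter.atTop (nhds fstar) := by
  have hKα : 0 < K + α := by linarith
  have hadj : ∀ y : H₂, ‖ContinuousLinearMap.adjoint A y‖ ^ 2 ≤ K * ‖y‖ ^ 2 := by
    intro y
    set z := ContinuousLinearMap.adjoint A y with hz
    have h1 : inner ℝ (A z) y = ‖z‖ ^ 2 := by
      rw [← ContinuousLinearMap.adjoint_inner_right, ← hz, real_inner_self_eq_norm_sq]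
    have h2 := norm_sub_sq_real (A z) (K • y)
    rw [inner_smul_right, h1, norm_smul, mul_pow, Real.norm_eq_abs, sq_abs] at h2
    have h3 := sq_nonneg ‖A z - K • y‖
    have h4 := hKA z
    have h5 : 0 ≤ K * (K * ‖y‖ ^ 2 - ‖z‖ ^ 2) := by nlinarith
    have := nonneg_of_mul_nonneg_right h5 hK
    linarith
  have hcon : ∀ d : H₁, ‖K • d - ContinuousLinearMap.adjoint A (A d)‖ ≤ K * ‖d‖ := by
    intro d
    refine (sq_le_sq₀ (norm_nonneg _) (by positivity)).mp ?_
    · rw [norm_sub_sq_real, inner_smul_left, ContinuousLinearMap.adjoint_inner_right,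
        real_inner_self_eq_norm_sq, norm_smul, mul_pow, Real.norm_eq_abs, sq_abs]
      simp only [conj_trivial]
      have := hadj (A d)
      have : 0 ≤ K * ‖A d‖ ^ 2 := by positivity
      nlinarith
  have hlip : ContractingWith (⟨K / (K + α), by positivity⟩ : NNReal) Φ := by
    constructor
    · apply NNReal.coe_lt_coe.mp
      change K / (K + α) < 1
      rw [div_lt_one hKα]
      linarith
    · apply LipschitzWith.of_dist_le_mul
      intro x y
      change _ ≤ K / (K + α) * _
      rw [dist_eq_norm, dist_eq_norm, hΦ, hΦ]
      have e : (1 / (K + α)) • (K • x - ContinuousLinearMap.adjoint A (A x - u)) -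
          (1 / (K + α)) • (K • y - ContinuousLinearMap.adjoint A (A y - u)) =
          (1 / (K + α)) • (K • (x - y) - ContinuousLinearMap.adjoint A (A (x - y))) := by
        rw [← smul_sub]
        congr 1
        simp only [map_sub, smul_sub]
        abel
      rw [e, norm_smul, Real.norm_of_nonneg (by positivity)]
      calc _ ≤ 1 / (K + α) * (K * ‖x - y‖) := by
            gcongr
            exact hcon _
        _ = _ := by ring
  have hit : seq = fun n => Φ^[n] f₀ := by
    funext n
    induction n with
    | zero => simpa using hseq0
    | succ k ih => rw [hseq, ih, Function.iterate_succ_apply']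
  obtain ⟨p, hp, hlim⟩ : ∃ p, Φ p = p ∧ Filter.Tendsto seq Filter.atTop (nhds p) := by
    refine ⟨hlip.fixedPoint Φ, hlip.fixedPoint_isFixedPt, ?_⟩
    rw [hit]
    exact hlip.tendsto_iterate_fixedPoint f₀
  have hEL : ContinuousLinearMap.adjoint A (A p - u) = -(α • p) := by
    have h := congrArg (fun v => (K + α) • v) hp
    simp only [hΦ, smul_smul, mul_one_div_cancel hKα.ne', one_smul, add_smul] at h
    rw [sub_eq_iff_eq_add] at h
    have h' : K • p + (α • p + ContinuousLinearMap.adjoint A (A p - u)) = K • p + 0 := by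
      rw [add_zero, ← add_assoc]
      exact h.symm
    exact eq_neg_of_add_eq_zero_right (add_left_cancel h')
  have hJ : ∀ f : H₁, ‖A f - u‖ ^ 2 + α * ‖f‖ ^ 2 =
      ‖A p - u‖ ^ 2 + α * ‖p‖ ^ 2 + ‖A (f - p)‖ ^ 2 + α * ‖f - p‖ ^ 2 := by
    intro f
    have e1 : A f - u = A (f - p) + (A p - u) := by
      rw [map_sub]
      abel
    have e2 : ‖f‖ ^ 2 = ‖f - p‖ ^ 2 + 2 * inner ℝ (f - p) p + ‖p‖ ^ 2 := by
      rw [← norm_add_sq_real, sub_add_cancel]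
    rw [e1, norm_add_sq_real, ← ContinuousLinearMap.adjoint_inner_right, hEL, inner_neg_right,
      inner_smul_right, e2]
    ring
  refine ⟨p, ?_, ?_, hlim⟩
  · intro f
    rw [hJ f]
    have : 0 ≤ α * ‖f - p‖ ^ 2 := by positivity
    have := sq_nonneg ‖A (f - p)‖
    linarith
  · intro f hf
    have h1 := hf p
    rw [hJ f] at h1
    have h2 := sq_nonneg ‖A (f - p)‖
    by_contra hne
    have h3 : 0 < ‖f - p‖ := norm_pos_iff.mpr (sub_ne_zero.mpr hne)
    have : 0 < α * ‖f - p‖ ^ 2 := by positivity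
    linarith
end

section
/- Let C > 0, β > 0, X ≥ 0, D > 0 and M > 0 be real numbers, and suppose X² ≤ C·e^{C s}·D² + C·e^{−2β s}·M² for every s ≥ 0. Set θ = 2β/(C + 2β) ∈ (0, 1). Then X ≤ √(2C)·D + √(2C)·M^{1−θ}·D^{θ}. -/
/-- Final stability step: if `X² ≤ C e^{Cs} D² + C e^{−2βs} M²` for all `s ≥ 0`, with
`D, M > 0`, then with `θ = 2β/(C + 2β) ∈ (0, 1)` one has
`X ≤ √(2C) D + √(2C) M^{1−θ} D^{θ}`. -/
theorem holder_stability_final_step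
    (C β X D M θ : ℝ) (hC : 0 < C) (hβ : 0 < β) (hX : 0 ≤ X)
    (hD : 0 < D) (hM : 0 < M)
    (hineq : ∀ s : ℝ, 0 ≤ s →
      X ^ 2 ≤ C * Real.exp (C * s) * D ^ 2 + C * Real.exp (-2 * β * s) * M ^ 2)
    (hθ : θ = 2 * β / (C + 2 * β)) :
    θ ∈ Set.Ioo (0 : ℝ) 1 ∧
      X ≤ Real.sqrt (2 * C) * D + Real.sqrt (2 * C) * M ^ (1 - θ) * D ^ θ := by
  have hpos : 0 < C + 2 * β := by positivity
  have h1 : 1 - θ = C / (C + 2 * β) := by rw [hθ]; field_simp; ring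
  have hθ0 : 0 < θ := by rw [hθ]; positivity
  have hθ1 : 0 < 1 - θ := by rw [h1]; positivity
  refine ⟨⟨hθ0, by linarith⟩, ?_⟩
  have hq : Real.sqrt (2 * C) ^ 2 = 2 * C := Real.sq_sqrt (by positivity)
  have hq0 : 0 ≤ Real.sqrt (2 * C) := Real.sqrt_nonneg _
  have hY0 : 0 ≤ M ^ (1 - θ) * D ^ θ := by positivity
  rw [mul_assoc]
  rcases le_total M D with h | h
  · have h0 := hineq 0 le_rfl
    simp only [mul_zero, Real.exp_zero, mul_one] at h0
    have hMD : M ^ 2 ≤ D ^ 2 := by gcongr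
    have : X ≤ Real.sqrt (2 * C) * D := by
      refine (sq_le_sq₀ hX (by positivity)).mp ?_
      rw [mul_pow, hq]
      nlinarith
    have := mul_nonneg hq0 hY0
    linarith
  · have hlog : Real.log D ≤ Real.log M := Real.log_le_log hD h
    have h0 := hineq (2 * (Real.log M - Real.log D) / (C + 2 * β))
      (div_nonneg (by linarith) hpos.le)
    have hY : (M ^ (1 - θ) * D ^ θ) ^ 2
        = Real.exp (2 * ((1 - θ) * Real.log M + θ * Real.log D)) := by
      rw [Real.rpow_def_of_pos hM, Real.rpow_def_of_pos hD, ← Real.exp_add, ← Real.exp_nat_mul]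
      congr 1; push_cast; ring
    have e1 : Real.exp (C * (2 * (Real.log M - Real.log D) / (C + 2 * β))) * D ^ 2
        = (M ^ (1 - θ) * D ^ θ) ^ 2 := by
      rw [hY]
      nth_rewrite 2 [← Real.exp_log hD]
      rw [← Real.exp_nat_mul, ← Real.exp_add, h1, hθ]
      congr 1; push_cast; field_simp; ring
    have e2 : Real.exp (-2 * β * (2 * (Real.log M - Real.log D) / (C + 2 * β))) * M ^ 2
        = (M ^ (1 - θ) * D ^ θ) ^ 2 := by
      rw [hY]
      nth_rewrite 2 [← Real.exp_log hM]
      rw [← Real.exp_nat_mul, ← Real.exp_add, h1, hθ]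
      congr 1; push_cast; field_simp; ring
    rw [mul_assoc, e1, mul_assoc C, e2] at h0
    have : X ≤ Real.sqrt (2 * C) * (M ^ (1 - θ) * D ^ θ) := by
      refine (sq_le_sq₀ hX (by positivity)).mp ?_
      rw [mul_pow, hq]
      linarith
    have := mul_nonneg hq0 hD.le
    linarith
end
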